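/- arXiv:1107.4752 — 3 statements merged into one kernel-verified Lean document; each statement's English description precedes it below -/
import Mathlib

section
/- For every real β > 0, every θ ∈ ℝ and every z ∈ ℤ, the discrete Gaussian family satisfies the shift identity μ^{θ+β}(z) = μ^θ(z − 1). (This is the key identity of Lemma 4.1: shifting the increased-parameter marginal by one site reproduces the original marginal, which makes the shock measure have product marginals.) -/
open scoped BigOperators

/-- Partition function `Z(θ) = ∑_{z ∈ ℤ} exp(θ z − β z²/2)`. -/
noncomputable def Zf (β θ : ℝ) : ℝ := ∑' z : ℤ, Real.exp (θ * (z : ℝ) - β * (z : ℝ)^2 / 2)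

/-- Discrete Gaussian probability mass function `μ^θ(z) = exp(θ z − β z²/2)/Z(θ)`. -/
noncomputable def mu (β θ : ℝ) (z : ℤ) : ℝ := Real.exp (θ * (z : ℝ) - β * (z : ℝ)^2 / 2) / Zf β θ

theorem exp_shift (β θ x : ℝ) :
    Real.exp ((θ + β) * x - β * x ^ 2 / 2) =
      Real.exp (θ + β / 2) * Real.exp (θ * (x - 1) - β * (x - 1) ^ 2 / 2) := by
  rw [← Real.exp_add]
  ring_nf

theorem Zf_add (β θ : ℝ) : Zf β (θ + β) = Real.exp (θ + β / 2) * Zf β θ := by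
  unfold Zf
  rw [← tsum_mul_left]
  conv_rhs => rw [← (Equiv.subRight (1 : ℤ)).tsum_eq]
  simp [exp_shift]

/-- the shift identity `μ^{θ+β}(z) = μ^θ(z − 1)`. -/
theorem stmt2 (β θ : ℝ) (hβ : 0 < β) (z : ℤ) :
    mu β (θ + β) z = mu β θ (z - 1) := by
  rw [mu, mu, Zf_add, exp_shift, mul_div_mul_left _ _ (Real.exp_ne_zero _)]
  push_cast
  rfl
end

section
/- For every real β > 0 and θ ∈ ℝ, the chi-square–type sum ∑_{y ∈ ℤ} μ̂^θ(y)²/μ^θ(y) is finite. (This is the finiteness of the Cauchy–Schwarz factor used in the proof of the tail bound for the second class particle, Lemma 4.6.) -/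
open scoped BigOperators

/-- The mean (density) `R(θ) = ∑_{z ∈ ℤ} z μ^θ(z)`. -/
noncomputable def Rmean (β θ : ℝ) : ℝ := ∑' z : ℤ, (z : ℝ) * mu β θ z


/-- The variance `Var(θ) = ∑_{z ∈ ℤ} (z − R(θ))² μ^θ(z)`. -/
noncomputable def Varmu (β θ : ℝ) : ℝ := ∑' z : ℤ, ((z : ℝ) - Rmean β θ)^2 * mu β θ z


/-- The tail sum `T^θ(y) = ∑_{z > y} (z − R(θ)) μ^θ(z)`. -/
noncomputable def Ttail (β θ : ℝ) (y : ℤ) : ℝ :=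
  ∑' z : {z : ℤ // y < z}, (((z : ℤ) : ℝ) - Rmean β θ) * mu β θ (z : ℤ)


/-- The size-biased tail distribution `μ̂^θ(y) = T^θ(y)/Var(θ)`. -/
noncomputable def muhat (β θ : ℝ) (y : ℤ) : ℝ := Ttail β θ y / Varmu β θ

/-- The weight of the discrete Gaussian is summable against every power of `|z|`. -/
lemma summable_abs_pow_mul_exp (β θ : ℝ) (hβ : 0 < β) (n : ℕ) :
    Summable (fun z : ℤ => |(z : ℝ)| ^ n * Real.exp (θ * z - β * (z : ℝ) ^ 2 / 2)) := by
  have hT : 0 < β / (2 * Real.pi) := by positivity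
  refine (summable_pow_mul_jacobiTheta₂_term_bound (|θ| / (2 * Real.pi)) hT n).of_nonneg_of_le
    (fun z => by positivity) (fun z => ?_)
  push_cast
  gcongr
  have hpi := Real.pi_pos.ne'
  have hexp : -Real.pi * (β / (2 * Real.pi) * (z : ℝ) ^ 2 - 2 * (|θ| / (2 * Real.pi)) * |(z : ℝ)|)
      = |θ| * |(z : ℝ)| - β * (z : ℝ) ^ 2 / 2 := by
    field_simp
    ring
  rw [hexp, ← abs_mul]
  linarith [le_abs_self (θ * (z : ℝ))]

lemma summable_exp (β θ : ℝ) (hβ : 0 < β) :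
    Summable (fun z : ℤ => Real.exp (θ * z - β * (z : ℝ) ^ 2 / 2)) := by
  simpa using summable_abs_pow_mul_exp β θ hβ 0

lemma Zf_pos (β θ : ℝ) (hβ : 0 < β) : 0 < Zf β θ :=
  (summable_exp β θ hβ).tsum_pos (fun _ => (Real.exp_pos _).le) 0 (Real.exp_pos _)

lemma mu_pos (β θ : ℝ) (hβ : 0 < β) (z : ℤ) : 0 < mu β θ z :=
  div_pos (Real.exp_pos _) (Zf_pos β θ hβ)

lemma summable_abs_pow_mul_mu (β θ : ℝ) (hβ : 0 < β) (n : ℕ) :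
    Summable (fun z : ℤ => |(z : ℝ)| ^ n * mu β θ z) := by
  simpa only [mu, mul_div_assoc] using (summable_abs_pow_mul_exp β θ hβ n).div_const (Zf β θ)

lemma summable_mu (β θ : ℝ) (hβ : 0 < β) : Summable (mu β θ) :=
  (summable_exp β θ hβ).div_const _

lemma tsum_mu (β θ : ℝ) (hβ : 0 < β) : ∑' z, mu β θ z = 1 := by
  simp only [mu, tsum_div_const]
  exact div_self (Zf_pos β θ hβ).ne'

lemma summable_mul_mu (β θ : ℝ) (hβ : 0 < β) : Summable (fun z : ℤ => (z : ℝ) * mu β θ z) := by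
  refine Summable.of_norm ((summable_abs_pow_mul_mu β θ hβ 1).congr fun z => ?_)
  rw [Real.norm_eq_abs, abs_mul, abs_of_pos (mu_pos β θ hβ z), pow_one]

lemma summable_sub_mean_mul_mu (β θ : ℝ) (hβ : 0 < β) :
    Summable (fun z : ℤ => ((z : ℝ) - Rmean β θ) * mu β θ z) := by
  simpa only [sub_mul] using (summable_mul_mu β θ hβ).sub ((summable_mu β θ hβ).mul_left _)

lemma tsum_sub_mean_mul_mu (β θ : ℝ) (hβ : 0 < β) :
    ∑' z : ℤ, ((z : ℝ) - Rmean β θ) * mu β θ z = 0 := by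
  simp only [sub_mul]
  rw [(summable_mul_mu β θ hβ).tsum_sub ((summable_mu β θ hβ).mul_left _), tsum_mul_left,
    tsum_mu β θ hβ, mul_one, ← Rmean, sub_self]

/-- The pmf at a point lying further from the origin than `y`, on the same side. -/
lemma mu_le_mu_mul_exp (β θ : ℝ) (hβ : 0 < β) {y z : ℤ} (h : 0 ≤ y * (z - y)) :
    mu β θ z ≤ mu β θ y * Real.exp (θ * ((z - y : ℤ) : ℝ) - β * ((z - y : ℤ) : ℝ) ^ 2 / 2) := by
  have hZ := Zf_pos β θ hβ
  have h' : (0 : ℝ) ≤ y * (z - y) := by exact_mod_cast h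
  rw [mu, mu, div_mul_eq_mul_div, ← Real.exp_add]
  gcongr
  push_cast
  nlinarith [mul_nonneg hβ.le h']

/-- The constant in the tail bound `abs_tsum_subtype_le`. -/
noncomputable def tailConst (β θ : ℝ) : ℝ :=
  ∑' k : ℤ, (1 + |Rmean β θ| + |(k : ℝ)|) * Real.exp (θ * k - β * (k : ℝ) ^ 2 / 2)

lemma summable_tailConst (β θ : ℝ) (hβ : 0 < β) :
    Summable (fun k : ℤ =>
      (1 + |Rmean β θ| + |(k : ℝ)|) * Real.exp (θ * k - β * (k : ℝ) ^ 2 / 2)) := by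
  simpa only [add_mul _ |_|, pow_one] using
    ((summable_exp β θ hβ).mul_left (1 + |Rmean β θ|)).add (summable_abs_pow_mul_exp β θ hβ 1)

lemma abs_tsum_subtype_le (β θ : ℝ) (hβ : 0 < β) (y : ℤ) (S : Set ℤ)
    (hS : ∀ z ∈ S, 0 ≤ y * (z - y)) :
    |∑' z : S, (((z : ℤ) : ℝ) - Rmean β θ) * mu β θ z| ≤
      tailConst β θ * ((1 + |(y : ℝ)|) * mu β θ y) := by
  set g : ℤ → ℝ := fun k =>
    (1 + |Rmean β θ| + |(k : ℝ)|) * Real.exp (θ * k - β * (k : ℝ) ^ 2 / 2) with hg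
  have hmy := mu_pos β θ hβ y
  have hsum : HasSum (fun z : ℤ => g (z - y) * ((1 + |(y : ℝ)|) * mu β θ y))
      (tailConst β θ * ((1 + |(y : ℝ)|) * mu β θ y)) :=
    ((Equiv.subRight y).hasSum_iff.mpr (summable_tailConst β θ hβ).hasSum).mul_right _
  rw [tsum_subtype S (fun z : ℤ => ((z : ℝ) - Rmean β θ) * mu β θ z), ← Real.norm_eq_abs]
  refine tsum_of_norm_bounded hsum fun z => ?_
  by_cases hz : z ∈ S
  · have hmz := mu_pos β θ hβ z
    have hlin : |(z : ℝ) - Rmean β θ| ≤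
        (1 + |Rmean β θ| + |((z - y : ℤ) : ℝ)|) * (1 + |(y : ℝ)|) := by
      have h1 : |(z : ℝ) - Rmean β θ| ≤ |(z : ℝ) - y| + |(y : ℝ)| + |Rmean β θ| := by
        calc |(z : ℝ) - Rmean β θ| = |((z : ℝ) - y) + y - Rmean β θ| := by ring_nf
          _ ≤ _ := (abs_sub _ _).trans (by gcongr; exact abs_add_le _ _)
      push_cast
      nlinarith [mul_nonneg (abs_nonneg (Rmean β θ)) (abs_nonneg (y : ℝ)),
        mul_nonneg (abs_nonneg ((z : ℝ) - y)) (abs_nonneg (y : ℝ))]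
    rw [Set.indicator_of_mem hz, norm_mul, Real.norm_eq_abs, Real.norm_of_nonneg hmz.le]
    calc |(z : ℝ) - Rmean β θ| * mu β θ z ≤ _ :=
          mul_le_mul hlin (mu_le_mu_mul_exp β θ hβ (hS z hz)) hmz.le (by positivity)
      _ = _ := by simp only [hg]; ring
  · rw [Set.indicator_of_notMem hz, norm_zero]
    positivity

lemma abs_Ttail_le (β θ : ℝ) (hβ : 0 < β) (y : ℤ) :
    |Ttail β θ y| ≤ tailConst β θ * ((1 + |(y : ℝ)|) * mu β θ y) := by
  rcases le_total 0 y with hy | hy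
  · exact abs_tsum_subtype_le β θ hβ y {z | y < z} fun z hz =>
      mul_nonneg hy (sub_nonneg.mpr (le_of_lt hz))
  · have hsplit := (summable_sub_mean_mul_mu β θ hβ).tsum_subtype_add_tsum_subtype_compl
      {z : ℤ | y < z}
    rw [tsum_sub_mean_mul_mu β θ hβ] at hsplit
    have hneg : Ttail β θ y =
        -∑' z : ({z : ℤ | y < z}ᶜ : Set ℤ), (((z : ℤ) : ℝ) - Rmean β θ) * mu β θ z :=
      eq_neg_of_add_eq_zero_left hsplit
    rw [hneg, abs_neg]
    exact abs_tsum_subtype_le β θ hβ y _ fun z hz =>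
      mul_nonneg_of_nonpos_of_nonpos hy (sub_nonpos.mpr (not_lt.mp hz))

/-- the chi-square type sum `∑_y μ̂^θ(y)²/μ^θ(y)` is finite. -/
theorem stmt10 (β θ : ℝ) (hβ : 0 < β) :
    Summable (fun y : ℤ => (muhat β θ y)^2 / mu β θ y) := by
  have hsq : Summable (fun y : ℤ => (1 + |(y : ℝ)|) ^ 2 * mu β θ y) :=
    (((summable_mu β θ hβ).add ((summable_abs_pow_mul_mu β θ hβ 1).mul_left 2)).add
      (summable_abs_pow_mul_mu β θ hβ 2)).congr fun y => by ring
  refine (hsq.mul_left (tailConst β θ ^ 2 / Varmu β θ ^ 2)).of_nonneg_of_le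
    (fun y => div_nonneg (sq_nonneg _) (mu_pos β θ hβ y).le) fun y => ?_
  have hm := mu_pos β θ hβ y
  have hT : Ttail β θ y ^ 2 ≤ (tailConst β θ * ((1 + |(y : ℝ)|) * mu β θ y)) ^ 2 :=
    sq_le_sq.mpr ((abs_Ttail_le β θ hβ y).trans (le_abs_self _))
  rw [div_le_iff₀ hm, muhat, div_pow]
  calc Ttail β θ y ^ 2 / Varmu β θ ^ 2
      ≤ (tailConst β θ * ((1 + |(y : ℝ)|) * mu β θ y)) ^ 2 / Varmu β θ ^ 2 := by gcongr
    _ = _ := by ring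
end

section
/- For every real β > 0, let Θ : ℝ → ℝ be the inverse of the strictly increasing bijective mean function R (so θ(ϱ) = Θ(ϱ) is the parameter corresponding to density ϱ). Then the hydrodynamic flux H(ϱ) = e^{Θ(ϱ)} + e^{−Θ(ϱ)} is a strictly convex function of ϱ ∈ ℝ (property (2.5): H″(ϱ) > 0). -/
open scoped BigOperators

/-- Unnormalized moments `∑_{z ∈ ℤ} z^k exp(θ z − β z²/2)` of the discrete Gaussian. -/
noncomputable def gaussMoment (β : ℝ) (k : ℕ) (θ : ℝ) : ℝ :=
  ∑' z : ℤ, (z : ℝ) ^ k * Real.exp (θ * (z : ℝ) - β * (z : ℝ) ^ 2 / 2)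

/-- A common summable bound for the terms of `gaussMoment β k θ` with `|θ| ≤ S`. -/
noncomputable def gaussBound (β : ℝ) (k : ℕ) (S : ℝ) (z : ℤ) : ℝ :=
  |(z : ℝ)| ^ k * Real.exp (S * |(z : ℝ)| - β * (z : ℝ) ^ 2 / 2)

theorem summable_gaussBound {β : ℝ} (hβ : 0 < β) (k : ℕ) (S : ℝ) :
    Summable (gaussBound β k S) := by
  have h := summable_pow_mul_jacobiTheta₂_term_bound (S / (2 * Real.pi))
    (T := β / (2 * Real.pi)) (by positivity) k
  refine h.congr fun z => ?_
  have hpi := Real.pi_pos.ne'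
  unfold gaussBound
  push_cast
  congr 2
  field_simp
  ring

theorem norm_gaussTerm_le {β S θ : ℝ} (hθ : |θ| ≤ S) (k : ℕ) (z : ℤ) :
    ‖(z : ℝ) ^ k * Real.exp (θ * (z : ℝ) - β * (z : ℝ) ^ 2 / 2)‖ ≤ gaussBound β k S z := by
  rw [norm_mul, norm_pow, Real.norm_eq_abs, Real.norm_eq_abs, Real.abs_exp]
  unfold gaussBound
  have h : θ * (z : ℝ) ≤ S * |(z : ℝ)| :=
    (le_abs_self _).trans (by rw [abs_mul]; gcongr)
  gcongr

theorem hasSum_gaussMoment {β : ℝ} (hβ : 0 < β) (k : ℕ) (θ : ℝ) :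
    HasSum (fun z : ℤ => (z : ℝ) ^ k * Real.exp (θ * (z : ℝ) - β * (z : ℝ) ^ 2 / 2))
      (gaussMoment β k θ) :=
  ((summable_gaussBound hβ k |θ|).of_norm_bounded fun z => norm_gaussTerm_le le_rfl k z).hasSum

theorem hasDerivAt_gaussMoment {β : ℝ} (hβ : 0 < β) (k : ℕ) (θ : ℝ) :
    HasDerivAt (gaussMoment β k) (gaussMoment β (k + 1) θ) θ := by
  have hmem : θ ∈ Metric.ball (0 : ℝ) (|θ| + 1) := by simp
  refine hasDerivAt_tsum_of_isPreconnected
    (g := fun (z : ℤ) t => (z : ℝ) ^ k * Real.exp (t * (z : ℝ) - β * (z : ℝ) ^ 2 / 2))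
    (g' := fun (z : ℤ) t => (z : ℝ) ^ (k + 1) * Real.exp (t * (z : ℝ) - β * (z : ℝ) ^ 2 / 2))
    (summable_gaussBound hβ (k + 1) (|θ| + 1)) Metric.isOpen_ball
    (convex_ball _ _).isPreconnected (fun z t _ => ?_) (fun z t ht => ?_) hmem
    (hasSum_gaussMoment hβ k θ).summable hmem
  · have h := ((((hasDerivAt_id t).mul_const (z : ℝ)).sub_const
      (β * (z : ℝ) ^ 2 / 2)).exp).const_mul ((z : ℝ) ^ k)
    refine h.congr_deriv ?_
    simp only [id]
    ring
  · refine norm_gaussTerm_le ?_ (k + 1) z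
    simpa using (mem_ball_zero_iff.mp ht).le

theorem gaussMoment_zero_pos {β : ℝ} (hβ : 0 < β) (θ : ℝ) : 0 < gaussMoment β 0 θ :=
  (hasSum_gaussMoment hβ 0 θ).summable.tsum_pos (fun z => by positivity) 0 (by positivity)

theorem Rmean_eq (β θ : ℝ) : Rmean β θ = gaussMoment β 1 θ / gaussMoment β 0 θ := by
  simp only [Rmean, mu, Zf, gaussMoment, pow_one, pow_zero, one_mul, ← mul_div_assoc, tsum_div_const]

/-- The variance of the discrete Gaussian. -/
noncomputable def gaussVar (β θ : ℝ) : ℝ :=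
  gaussMoment β 2 θ / gaussMoment β 0 θ - Rmean β θ ^ 2

/-- The third central moment of the discrete Gaussian. -/
noncomputable def gaussThird (β θ : ℝ) : ℝ :=
  gaussMoment β 3 θ / gaussMoment β 0 θ
    - 3 * Rmean β θ * (gaussMoment β 2 θ / gaussMoment β 0 θ) + 2 * Rmean β θ ^ 3

theorem hasDerivAt_Rmean {β : ℝ} (hβ : 0 < β) (θ : ℝ) :
    HasDerivAt (Rmean β) (gaussVar β θ) θ := by
  have h0 := (gaussMoment_zero_pos hβ θ).ne'
  rw [funext (Rmean_eq β)]
  refine ((hasDerivAt_gaussMoment hβ 1 θ).div (hasDerivAt_gaussMoment hβ 0 θ) h0).congr_deriv ?_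
  rw [gaussVar, Rmean_eq]
  field_simp

theorem hasDerivAt_gaussVar {β : ℝ} (hβ : 0 < β) (θ : ℝ) :
    HasDerivAt (gaussVar β) (gaussThird β θ) θ := by
  have h0 := (gaussMoment_zero_pos hβ θ).ne'
  refine (((hasDerivAt_gaussMoment hβ 2 θ).div (hasDerivAt_gaussMoment hβ 0 θ) h0).sub
    ((hasDerivAt_Rmean hβ θ).pow 2)).congr_deriv ?_
  rw [gaussThird, gaussVar, Rmean_eq]
  norm_num
  field_simp
  ring

theorem HasSum.of_eq {ι : Type*} {f g : ι → ℝ} {a b : ℝ} (h : HasSum f a)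
    (hfg : ∀ i, g i = f i) (hab : b = a) : HasSum g b := by
  rwa [funext hfg, hab]

theorem hasSum_quadratic {β : ℝ} (hβ : 0 < β) (θ a b c : ℝ) :
    HasSum (fun z : ℤ => (a * (z : ℝ) ^ 2 + b * z + c) *
        Real.exp (θ * (z : ℝ) - β * (z : ℝ) ^ 2 / 2))
      (a * gaussMoment β 2 θ + b * gaussMoment β 1 θ + c * gaussMoment β 0 θ) := by
  refine HasSum.of_eq ((((hasSum_gaussMoment hβ 2 θ).mul_left a).add
    ((hasSum_gaussMoment hβ 1 θ).mul_left b)).add ((hasSum_gaussMoment hβ 0 θ).mul_left c))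
    (fun z => ?_) rfl
  ring

theorem gaussVar_pos {β : ℝ} (hβ : 0 < β) (θ : ℝ) : 0 < gaussVar β θ := by
  have h0 := gaussMoment_zero_pos hβ θ
  have h := hasSum_quadratic hβ θ 1 (-2 * Rmean β θ) (Rmean β θ ^ 2)
  have hsq : ∀ z : ℤ, 1 * (z : ℝ) ^ 2 + -2 * Rmean β θ * z + Rmean β θ ^ 2
      = ((z : ℝ) - Rmean β θ) ^ 2 := fun z => by ring
  simp only [hsq] at h
  have hpos : 0 < ∑' z : ℤ, ((z : ℝ) - Rmean β θ) ^ 2 *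
      Real.exp (θ * (z : ℝ) - β * (z : ℝ) ^ 2 / 2) := by
    refine h.summable.tsum_pos (fun z => by positivity) (⌊Rmean β θ⌋ + 1) ?_
    have : (0 : ℝ) < ((⌊Rmean β θ⌋ + 1 : ℤ) : ℝ) - Rmean β θ := by
      push_cast; linarith [Int.lt_floor_add_one (Rmean β θ)]
    positivity
  rw [h.tsum_eq] at hpos
  have e : gaussVar β θ = (1 * gaussMoment β 2 θ + -2 * Rmean β θ * gaussMoment β 1 θ
      + Rmean β θ ^ 2 * gaussMoment β 0 θ) / gaussMoment β 0 θ := by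
    rw [gaussVar, Rmean_eq]
    field_simp
    ring
  rw [e]
  positivity

/-- A strictly convex function minus its chord through `r₁, r₂` has the sign of
`(x - r₁) (x - r₂)`. -/
theorem StrictConvexOn.chord_mul_pos {g : ℝ → ℝ} (hg : StrictConvexOn ℝ Set.univ g)
    {r₁ r₂ x : ℝ} (hr : r₁ < r₂) (h₁ : x ≠ r₁) (h₂ : x ≠ r₂) :
    0 < (g x - (g r₁ + (g r₂ - g r₁) / (r₂ - r₁) * (x - r₁))) * ((x - r₁) * (x - r₂)) := by
  have hslope {a b c : ℝ} (hab : a < b) (hbc : b < c) :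
      (g b - g a) * (c - b) < (g c - g b) * (b - a) := by
    have h := hg.slope_strict_mono_adjacent (Set.mem_univ a) (Set.mem_univ c) hab hbc
    rwa [div_lt_div_iff₀ (sub_pos.2 hab) (sub_pos.2 hbc)] at h
  have hd : 0 < r₂ - r₁ := sub_pos.2 hr
  have e : g x - (g r₁ + (g r₂ - g r₁) / (r₂ - r₁) * (x - r₁))
      = ((g x - g r₁) * (r₂ - r₁) - (g r₂ - g r₁) * (x - r₁)) / (r₂ - r₁) := by
    field_simp
    ring
  rw [e, div_mul_eq_mul_div]
  refine div_pos ?_ hd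
  rcases lt_or_gt_of_ne h₁ with h | h
  · exact mul_pos (by linarith [hslope h hr])
      (mul_pos_of_neg_of_neg (by linarith) (by linarith))
  rcases lt_or_gt_of_ne h₂ with h' | h'
  · exact mul_pos_of_neg_of_neg (by linarith [hslope h h'])
      (mul_neg_of_pos_of_neg (by linarith) (by linarith))
  · exact mul_pos (by linarith [hslope hr h']) (mul_pos (by linarith) (by linarith))

/-- A quadratic with two real roots that is orthogonal to affine functions pairs positively with
every strictly convex function. -/
theorem StrictConvexOn.hasSum_mul_quadratic_pos {g : ℝ → ℝ} (hg : StrictConvexOn ℝ Set.univ g)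
    {w : ℤ → ℝ} (hw : ∀ z, 0 < w z) {a r₁ r₂ s : ℝ} (ha : 0 < a) (hr : r₁ < r₂)
    (h0 : HasSum (fun z : ℤ => a * ((z - r₁) * (z - r₂)) * w z) 0)
    (h1 : HasSum (fun z : ℤ => (z : ℝ) * (a * ((z - r₁) * (z - r₂)) * w z)) 0)
    (hs : HasSum (fun z : ℤ => g z * (a * ((z - r₁) * (z - r₂)) * w z)) s) : 0 < s := by
  set γ := (g r₂ - g r₁) / (r₂ - r₁)
  have hsum : HasSum (fun z : ℤ => a * w z *
      ((g z - (g r₁ + γ * (z - r₁))) * ((z - r₁) * (z - r₂)))) s := by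
    have h := (hs.sub (h0.mul_left (g r₁ - γ * r₁))).sub (h1.mul_left γ)
    simp only [mul_zero, sub_zero] at h
    refine h.of_eq (fun z => ?_) rfl
    ring
  rw [← hsum.tsum_eq]
  refine hsum.summable.tsum_pos (fun z => ?_) (⌊r₂⌋ + 1) ?_
  · refine mul_nonneg (mul_pos ha (hw z)).le ?_
    by_cases h₁ : (z : ℝ) = r₁
    · simp [h₁]
    by_cases h₂ : (z : ℝ) = r₂
    · simp [h₂]
    exact (hg.chord_mul_pos hr h₁ h₂).le
  · have h : r₂ < ((⌊r₂⌋ + 1 : ℤ) : ℝ) := by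
      push_cast; exact Int.lt_floor_add_one r₂
    exact mul_pos (mul_pos ha (hw _)) (hg.chord_mul_pos hr (hr.trans h).ne' h.ne')

theorem strictConvexOn_exp_mul {c : ℝ} (hc : c ≠ 0) :
    StrictConvexOn ℝ Set.univ (fun x : ℝ => Real.exp (c * x)) := by
  refine ⟨convex_univ, fun x _ y _ hxy a b ha hb hab => ?_⟩
  have h := strictConvexOn_exp.2 (Set.mem_univ (c * x)) (Set.mem_univ (c * y))
    (fun h => hxy (mul_left_cancel₀ hc h)) ha hb hab
  simp only [smul_eq_mul] at h ⊢
  convert h using 2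
  ring

theorem exists_roots_of_pos {a b c : ℝ} (ha : 0 < a) (hc : 0 < c) :
    ∃ r₁ r₂ : ℝ, r₁ < r₂ ∧ ∀ x : ℝ, a * x ^ 2 + b * x - c = a * ((x - r₁) * (x - r₂)) := by
  have hD : 0 < b ^ 2 + 4 * a * c := by positivity
  have hs := Real.sq_sqrt hD.le
  have hs0 := Real.sqrt_pos.2 hD
  set d := √(b ^ 2 + 4 * a * c)
  refine ⟨(-b - d) / (2 * a), (-b + d) / (2 * a), by gcongr; linarith, fun x => ?_⟩
  field_simp
  linear_combination hs

/-- The third central moment is dominated by the variance. -/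
theorem gaussVar_sub_mul_gaussThird_pos {β : ℝ} (hβ : 0 < β) (θ : ℝ) {ε : ℤ} (hε : ε ^ 2 = 1) :
    0 < gaussVar β θ - ε * gaussThird β θ := by
  have h0 := gaussMoment_zero_pos hβ θ
  have hε' : (ε : ℝ) ^ 2 = 1 := by exact_mod_cast hε
  have hε0 : (ε : ℝ) ≠ 0 := fun h => by simp [h] at hε'
  have hV := gaussVar_pos hβ θ
  set V := gaussVar β θ with hVdef
  set κ := gaussThird β θ with hκdef
  set m := Rmean β θ with hm
  have e1 : gaussMoment β 1 θ = m * gaussMoment β 0 θ := by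
    rw [hm, Rmean_eq]; field_simp
  have e2 : gaussMoment β 2 θ = (V + m ^ 2) * gaussMoment β 0 θ := by
    rw [hVdef, gaussVar]; field_simp; ring
  have e3 : gaussMoment β 3 θ = (κ + 3 * m * (V + m ^ 2) - 2 * m ^ 3) * gaussMoment β 0 θ := by
    rw [hκdef, hVdef, gaussThird, gaussVar]; field_simp; ring
  obtain ⟨t₁, t₂, ht, hroots⟩ := exists_roots_of_pos (b := -κ) hV (pow_pos hV 2)
  have hq (x : ℝ) : V * ((x - (m + t₁)) * (x - (m + t₂)))
      = V * x ^ 2 + (-2 * V * m - κ) * x + (V * m ^ 2 + κ * m - V ^ 2) := by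
    linear_combination -hroots (x - m)
  have hpos := (strictConvexOn_exp_mul (mul_ne_zero hε0 hβ.ne')).hasSum_mul_quadratic_pos
    (w := fun z : ℤ => Real.exp (θ * (z : ℝ) - β * (z : ℝ) ^ 2 / 2))
    (a := V) (r₁ := m + t₁) (r₂ := m + t₂)
    (s := Real.exp (ε * θ + β / 2) * ((V - ε * κ) * gaussMoment β 0 θ))
    (fun z => Real.exp_pos _) hV (by linarith) ?_ ?_ ?_
  · exact pos_of_mul_pos_left (pos_of_mul_pos_right hpos (Real.exp_pos _).le) h0.le
  · simp only [hq]
    refine (hasSum_quadratic hβ θ V (-2 * V * m - κ) (V * m ^ 2 + κ * m - V ^ 2)).of_eq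
      (fun z => rfl) ?_
    rw [e1, e2]; ring
  · simp only [hq]
    refine (((hasSum_gaussMoment hβ 3 θ).mul_left V).add
      (hasSum_quadratic hβ θ (-2 * V * m - κ) (V * m ^ 2 + κ * m - V ^ 2) 0)).of_eq
      (fun z => ?_) ?_
    · ring
    · rw [e1, e2, e3]; ring
  · rw [← (Equiv.addRight ε).hasSum_iff]
    have h := (hasSum_quadratic hβ θ V (2 * V * ε + (-2 * V * m - κ))
      (V * ε ^ 2 + (-2 * V * m - κ) * ε + (V * m ^ 2 + κ * m - V ^ 2))).mul_left
      (Real.exp (ε * θ + β / 2))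
    refine h.of_eq (fun z => ?_) ?_
    · simp only [Function.comp, Equiv.coe_addRight, hq]
      push_cast
      have hexp : Real.exp (ε * β * (z + ε)) * Real.exp (θ * (z + ε) - β * (z + ε) ^ 2 / 2)
          = Real.exp (ε * θ + β / 2) * Real.exp (θ * z - β * (z : ℝ) ^ 2 / 2) := by
        rw [← Real.exp_add, ← Real.exp_add]
        congr 1
        linear_combination (β / 2) * hε'
      linear_combination (V * ((z : ℝ) + ε) ^ 2 + (-2 * V * m - κ) * (z + ε)
        + (V * m ^ 2 + κ * m - V ^ 2)) * hexp
    · rw [e1, e2, hε']; ring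

theorem hasDerivAt_of_inverse_Rmean {β : ℝ} (hβ : 0 < β) {Θ : ℝ → ℝ}
    (hleft : Function.LeftInverse Θ (Rmean β)) (hright : Function.RightInverse Θ (Rmean β))
    (ϱ : ℝ) : HasDerivAt Θ (gaussVar β (Θ ϱ))⁻¹ ϱ := by
  have hmono : StrictMono (Rmean β) := strictMono_of_deriv_pos fun θ => by
    rw [(hasDerivAt_Rmean hβ θ).deriv]
    exact gaussVar_pos hβ θ
  have hΘ : Monotone Θ := fun x y hxy => by
    rw [← hmono.le_iff_le, hright x, hright y]
    exact hxy
  exact (hasDerivAt_Rmean hβ (Θ ϱ)).of_local_left_inverse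
    (hΘ.continuous_of_surjective hleft.surjective).continuousAt (gaussVar_pos hβ _).ne'
    (Filter.Eventually.of_forall hright)

/-- with Θ the inverse of the strictly increasing bijection R,
the hydrodynamic flux `H(ϱ) = e^{Θ(ϱ)} + e^{−Θ(ϱ)}` is strictly convex, with
strictly positive second derivative. -/
theorem stmt17 (β : ℝ) (hβ : 0 < β) (Θ : ℝ → ℝ)
    (hleft : Function.LeftInverse Θ (Rmean β))
    (hright : Function.RightInverse Θ (Rmean β)) :
    StrictConvexOn ℝ Set.univ (fun ϱ : ℝ => Real.exp (Θ ϱ) + Real.exp (-(Θ ϱ))) ∧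
    (∀ ϱ : ℝ, 0 < iteratedDeriv 2 (fun ϱ : ℝ => Real.exp (Θ ϱ) + Real.exp (-(Θ ϱ))) ϱ) := by
  have hΘ := hasDerivAt_of_inverse_Rmean hβ hleft hright
  have hH (ϱ : ℝ) : HasDerivAt (fun ϱ : ℝ => Real.exp (Θ ϱ) + Real.exp (-(Θ ϱ)))
      ((Real.exp (Θ ϱ) - Real.exp (-(Θ ϱ))) / gaussVar β (Θ ϱ)) ϱ :=
    ((hΘ ϱ).exp.add (hΘ ϱ).fun_neg.exp).congr_deriv (by ring)
  have hpos (ϱ : ℝ) :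
      0 < iteratedDeriv 2 (fun ϱ : ℝ => Real.exp (Θ ϱ) + Real.exp (-(Θ ϱ))) ϱ := by
    have hV := gaussVar_pos hβ (Θ ϱ)
    have hd := ((hΘ ϱ).exp.sub (hΘ ϱ).fun_neg.exp).div
      ((hasDerivAt_gaussVar hβ (Θ ϱ)).comp ϱ (hΘ ϱ)) hV.ne'
    have h₁ := gaussVar_sub_mul_gaussThird_pos hβ (Θ ϱ) (ε := 1) (by norm_num)
    have h₂ := gaussVar_sub_mul_gaussThird_pos hβ (Θ ϱ) (ε := -1) (by norm_num)
    push_cast at h₁ h₂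
    have e : iteratedDeriv 2 (fun ϱ : ℝ => Real.exp (Θ ϱ) + Real.exp (-(Θ ϱ))) ϱ
        = (Real.exp (Θ ϱ) * (gaussVar β (Θ ϱ) - 1 * gaussThird β (Θ ϱ))
          + Real.exp (-(Θ ϱ)) * (gaussVar β (Θ ϱ) - -1 * gaussThird β (Θ ϱ)))
          / gaussVar β (Θ ϱ) ^ 3 := by
      rw [iteratedDeriv_succ, iteratedDeriv_one, funext fun x => (hH x).deriv]
      refine (hd.congr_deriv ?_).deriv
      simp only [Function.comp, Pi.sub_apply]
      field_simp
      ring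
    rw [e]
    positivity
  refine ⟨strictConvexOn_univ_of_deriv2_pos
    (continuous_iff_continuousAt.2 fun ϱ => (hH ϱ).continuousAt) fun ϱ => ?_, hpos⟩
  rw [← iteratedDeriv_eq_iterate]
  exact hpos ϱ
end
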